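/- Let G be an invertible n×n real matrix with singular values σ₁ ≥ σ₂ ≥ … ≥ σₙ > 0, and let 4 ≤ m < n. Let x₀ be a random vector in ℝⁿ distributed as the Gaussian N(0, GGᵀ), and let A be an m×n random matrix with i.i.d. standard Gaussian N(0,1) entries, independent of x₀. With probability one the matrix AGGᵀAᵀ is invertible; on this event define the maximum-likelihood estimator x̂ = G·Gᵀ Aᵀ (A G Gᵀ Aᵀ)⁻¹ A G · G⁻¹ x₀ (this is the maximizer of the N(0,GGᵀ) density over the affine space {x : A x = A x₀}). Then ∑_{i>m} σᵢ² ≤ E_A E_{x₀} ‖x̂ − x₀‖² ≤ m · ∑_{i>m−2} σᵢ², where ‖·‖ is the Euclidean norm on ℝⁿ. -/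

import Mathlib

open MeasureTheory ProbabilityTheory Matrix Finset

/-- The standard Gaussian measure `N(0, Iₙ)` on `ℝⁿ`: coordinates are i.i.d. `N(0,1)`. -/
noncomputable def stdGaussianVec (n : ℕ) : Measure (Fin n → ℝ) :=
  Measure.pi fun _ => gaussianReal 0 1

/-- The law of an `m × n` random matrix with i.i.d. standard Gaussian `N(0,1)` entries. -/
noncomputable def stdGaussianMat (m n : ℕ) : Measure (Fin m → Fin n → ℝ) :=
  Measure.pi fun _ => stdGaussianVec n

instance (n : ℕ) : IsProbabilityMeasure (stdGaussianVec n) := by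
  unfold stdGaussianVec; infer_instance

instance (m n : ℕ) : IsProbabilityMeasure (stdGaussianMat m n) := by
  unfold stdGaussianMat; infer_instance

@[fun_prop]
lemma measurable_mulVec_left {p n : ℕ} (W : Matrix (Fin p) (Fin n) ℝ) :
    Measurable fun x : Fin n → ℝ => W *ᵥ x :=
  (Continuous.matrix_mulVec continuous_const continuous_id).measurable

/-- The standard Gaussian law is preserved by matrices with orthonormal rows. -/
lemma measurePreserving_mulVec_stdGaussianVec {p n : ℕ} (W : Matrix (Fin p) (Fin n) ℝ)
    (hW : W * Wᵀ = 1) :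
    MeasurePreserving (fun x => W *ᵥ x) (stdGaussianVec n) (stdGaussianVec p) := by
  refine ⟨by fun_prop, ?_⟩
  have : IsProbabilityMeasure ((stdGaussianVec n).map fun x => W *ᵥ x) :=
    Measure.isProbabilityMeasure_map (by fun_prop)
  refine charFun_eq_pi_iff.1 fun t => ?_
  have h1 : charFun (((stdGaussianVec n).map fun x => W *ᵥ x).map (WithLp.toLp 2)) t =
      charFun ((stdGaussianVec n).map (WithLp.toLp 2)) (WithLp.toLp 2 (Wᵀ *ᵥ t.ofLp)) := by
    rw [Measure.map_map (by fun_prop) (by fun_prop)]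
    rw [charFun_apply, charFun_apply, integral_map (by fun_prop) (by fun_prop),
      integral_map (by fun_prop) (by fun_prop)]
    refine integral_congr_ae (.of_forall fun x => ?_)
    have : inner ℝ (WithLp.toLp 2 (W *ᵥ x)) t = inner ℝ (WithLp.toLp 2 x)
        (WithLp.toLp 2 (Wᵀ *ᵥ t.ofLp)) := by
      rw [EuclideanSpace.inner_eq_star_dotProduct, EuclideanSpace.inner_eq_star_dotProduct]
      simp [Matrix.mulVec_transpose, Matrix.dotProduct_mulVec]
    simp only [Function.comp, this]
  rw [h1, stdGaussianVec, charFun_pi]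
  simp_rw [charFun_gaussianReal, ← Complex.exp_sum]
  have h2 : ∑ j, (Wᵀ *ᵥ t.ofLp) j ^ 2 = ∑ i, t.ofLp i ^ 2 := by
    have : (Wᵀ *ᵥ t.ofLp) ⬝ᵥ (Wᵀ *ᵥ t.ofLp) = t.ofLp ⬝ᵥ t.ofLp := by
      rw [Matrix.mulVec_transpose, ← Matrix.dotProduct_mulVec, Matrix.mulVec_vecMul,
         hW]
      simp
    simpa [dotProduct, sq] using this
  congr 1
  simp only [Complex.ofReal_zero, mul_zero, zero_mul, zero_sub, NNReal.coe_one, Complex.ofReal_one,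
    one_mul, Finset.sum_neg_distrib, ← Finset.sum_div]
  congr 2
  exact_mod_cast h2

lemma memLp_eval_stdGaussianVec {n : ℕ} (i : Fin n) :
    MemLp (fun z : Fin n → ℝ => z i) 2 (stdGaussianVec n) :=
  (memLp_id_gaussianReal 2).comp_measurePreserving
    (measurePreserving_eval (fun _ : Fin n => gaussianReal 0 1) i)

lemma integrable_dotProduct_sq {n : ℕ} (c : Fin n → ℝ) :
    Integrable (fun z => (c ⬝ᵥ z) ^ 2) (stdGaussianVec n) := by
  refine MemLp.integrable_sq ?_
  exact memLp_finsetSum _ fun i _ => (memLp_eval_stdGaussianVec i).const_mul (c i)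

lemma integral_dotProduct_sq {n : ℕ} (c : Fin n → ℝ) :
    ∫ z, (c ⬝ᵥ z) ^ 2 ∂stdGaussianVec n = ∑ i, c i ^ 2 := by
  have h (i : Fin n) : MemLp (fun z : Fin n → ℝ => c i * z i) 2 (stdGaussianVec n) :=
    (memLp_eval_stdGaussianVec i).const_mul _
  have hmap (i : Fin n) : (stdGaussianVec n).map (fun z => z i) = gaussianReal 0 1 :=
    (measurePreserving_eval (fun _ : Fin n => gaussianReal 0 1) i).map_eq
  have hmean : ∫ z, c ⬝ᵥ z ∂stdGaussianVec n = 0 := by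
    simp only [dotProduct]
    rw [integral_finsetSum _ fun i _ => (h i).integrable (by norm_num)]
    refine Finset.sum_eq_zero fun i _ => ?_
    rw [integral_const_mul, ← integral_map (φ := fun z : Fin n → ℝ => z i) (f := fun x => x)
      (measurable_pi_apply i).aemeasurable (by fun_prop), hmap]
    simp
  have hvar (i : Fin n) : variance (fun z : Fin n → ℝ => c i * z i) (stdGaussianVec n) =
      c i ^ 2 := by
    rw [variance_const_mul, ← variance_id_map (measurable_pi_apply i).aemeasurable, hmap]
    simp
  rw [← variance_of_integral_eq_zero (Measurable.aemeasurable (by unfold dotProduct; fun_prop))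
    hmean]
  have hind := iIndepFun_pi (μ := fun _ : Fin n => gaussianReal 0 1)
    (X := fun i (x : ℝ) => c i * x) (fun i => by fun_prop)
  have := IndepFun.variance_sum (s := Finset.univ) (fun i _ => h i)
    (fun i _ j _ hij => hind.indepFun hij)
  simp only [hvar] at this
  rw [← this]
  congr 1
  ext z
  simp [dotProduct]

lemma lintegral_exp_neg_mul_sq {t : ℝ} (ht : 0 < t) :
    ∫⁻ x, ENNReal.ofReal (Real.exp (-t * x ^ 2)) ∂gaussianReal 0 1 =
      ENNReal.ofReal ((1 + 2 * t) ^ (-(1 / 2) : ℝ)) := by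
  rw [← ofReal_integral_eq_lintegral_ofReal, integral_gaussianReal_eq_integral_smul one_ne_zero]
  · have : ∀ x : ℝ, gaussianPDFReal 0 1 x • Real.exp (-t * x ^ 2) =
        (√(2 * Real.pi))⁻¹ * Real.exp (-(t + 1 / 2) * x ^ 2) := fun x => by
      have hexp : -(x - 0) ^ 2 / (2 * ((1 : NNReal) : ℝ)) + -t * x ^ 2 =
          -(t + 1 / 2) * x ^ 2 := by
        push_cast
        ring
      simp only [gaussianPDFReal, smul_eq_mul, mul_assoc, ← Real.exp_add, hexp]
      simp
    simp_rw [this]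
    rw [integral_const_mul, integral_gaussian, Real.rpow_neg (by positivity), ← Real.sqrt_eq_rpow,
      ← Real.sqrt_inv, ← Real.sqrt_inv, ← Real.sqrt_mul (by positivity)]
    congr 2
    field_simp
    ring
  · refine Integrable.of_bound (by fun_prop) 1 (.of_forall fun x => ?_)
    simp
    positivity
  · exact .of_forall fun x => by positivity

lemma lintegral_Ioi_exp_neg_mul {r : ℝ} (hr : 0 < r) :
    ∫⁻ t in Set.Ioi (0 : ℝ), ENNReal.ofReal (Real.exp (-t * r)) = ENNReal.ofReal r⁻¹ := by
  have h : ∀ t, -t * r = (-r) * t := fun t => by ring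
  simp_rw [h]
  rw [← ofReal_integral_eq_lintegral_ofReal, integral_exp_mul_Ioi (by linarith)]
  · simp
  · exact integrableOn_exp_mul_Ioi (by linarith) _
  · exact .of_forall fun x => by positivity

lemma lintegral_Ioi_one_add_two_mul_rpow :
    ∫⁻ t in Set.Ioi (0 : ℝ), ENNReal.ofReal ((1 + 2 * t) ^ (-(3 / 2) : ℝ)) = 1 := by
  have hd : ∀ x ∈ Set.Ici (0:ℝ), HasDerivAt (fun t : ℝ => -(1 + 2 * t) ^ (-(1 / 2) : ℝ))
      ((1 + 2 * x) ^ (-(3 / 2) : ℝ)) x := fun x hx => by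
    have hx : (0:ℝ) ≤ x := hx
    have h := (((hasDerivAt_id x).const_mul 2).const_add 1).rpow_const (p := (-(1 / 2) : ℝ))
      (.inl (by simp; positivity))
    refine h.neg.congr_deriv ?_
    norm_num
  have ht : Filter.Tendsto (fun t : ℝ => -(1 + 2 * t) ^ (-(1 / 2) : ℝ)) Filter.atTop
      (nhds (-0)) := by
    refine Filter.Tendsto.neg ((tendsto_rpow_neg_atTop (by norm_num)).comp ?_)
    exact Filter.tendsto_atTop_add_const_left _ _ (Filter.tendsto_id.const_mul_atTop (by norm_num))
  have hp : ∀ x ∈ Set.Ioi (0:ℝ), 0 ≤ (1 + 2 * x) ^ (-(3 / 2) : ℝ) := fun x hx => by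
    have hx : (0:ℝ) < x := hx
    positivity
  rw [← ofReal_integral_eq_lintegral_ofReal, integral_Ioi_of_hasDerivAt_of_nonneg' hd hp ht]
  · simp
  · exact integrableOn_Ioi_deriv_of_nonneg' hd hp ht
  · exact (ae_restrict_iff' measurableSet_Ioi).2 (.of_forall hp)

/-- The mean of `1 / χ²₃` is one. -/
lemma lintegral_lintegral_exp_neg_norm_sq :
    ∫⁻ x, (∫⁻ t in Set.Ioi (0 : ℝ), ENNReal.ofReal (Real.exp (-t * ∑ l, x l ^ 2)))
      ∂stdGaussianVec 3 = 1 := by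
  rw [lintegral_lintegral_swap (by fun_prop), ← lintegral_Ioi_one_add_two_mul_rpow]
  refine setLIntegral_congr_fun measurableSet_Ioi fun t (ht : 0 < t) => ?_
  have hbound {s : ℝ} (hs : 0 ≤ s) : ‖Real.exp (-t * s)‖ ≤ 1 := by
    simp
    positivity
  rw [← ofReal_integral_eq_lintegral_ofReal]
  · simp_rw [Finset.mul_sum, Real.exp_sum, stdGaussianVec]
    rw [integral_fintype_prod_eq_prod (fun (_ : Fin 3) (x : ℝ) => Real.exp (-t * x ^ 2))]
    have h := lintegral_exp_neg_mul_sq ht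
    rw [← ofReal_integral_eq_lintegral_ofReal, ENNReal.ofReal_eq_ofReal_iff] at h
    · rw [h, Finset.prod_const, ← Real.rpow_natCast, ← Real.rpow_mul (by positivity)]
      norm_num
    · exact integral_nonneg fun x => by positivity
    · positivity
    · exact Integrable.of_bound (Measurable.aestronglyMeasurable (by fun_prop)) 1
        (.of_forall fun x => hbound (by positivity))
    · exact .of_forall fun x => by positivity
  · exact Integrable.of_bound (Measurable.aestronglyMeasurable (by fun_prop)) 1
      (.of_forall fun x => hbound (by positivity))
  · exact .of_forall fun x => by positivity

lemma lintegral_lintegral_exp_neg_norm_mulVec_sq {m : ℕ} (W : Matrix (Fin 3) (Fin m) ℝ)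
    (hW : W * Wᵀ = 1) :
    ∫⁻ b, (∫⁻ t in Set.Ioi (0 : ℝ), ENNReal.ofReal (Real.exp (-t * ∑ l, (W *ᵥ b) l ^ 2)))
      ∂stdGaussianVec m = 1 := by
  rw [← lintegral_lintegral_exp_neg_norm_sq]
  exact (measurePreserving_mulVec_stdGaussianVec W hW).lintegral_comp (f := fun x =>
    ∫⁻ t in Set.Ioi (0 : ℝ), ENNReal.ofReal (Real.exp (-t * ∑ l, x l ^ 2)))
    (Measurable.lintegral_prod_right (by fun_prop))

section RangeProj

variable {ι κ : Type*} [Fintype ι] [Fintype κ] [DecidableEq κ]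

/-- The orthogonal projection onto the column space of a matrix of full column rank. -/
noncomputable def rangeProj (M : Matrix ι κ ℝ) : Matrix ι ι ℝ :=
  M * (Mᵀ * M)⁻¹ * Mᵀ

lemma transpose_rangeProj (M : Matrix ι κ ℝ) : (rangeProj M)ᵀ = rangeProj M := by
  simp [rangeProj, Matrix.transpose_nonsing_inv, Matrix.mul_assoc]

lemma rangeProj_mul_self {M : Matrix ι κ ℝ} (hM : IsUnit (Mᵀ * M).det) :
    rangeProj M * M = M := by
  rw [rangeProj, Matrix.mul_assoc, Matrix.mul_assoc, Matrix.nonsing_inv_mul _ hM, Matrix.mul_one]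

lemma isIdempotentElem_rangeProj {M : Matrix ι κ ℝ} (hM : IsUnit (Mᵀ * M).det) :
    rangeProj M * rangeProj M = rangeProj M := by
  conv_lhs => rw [rangeProj, ← Matrix.mul_assoc, ← Matrix.mul_assoc]
  rw [← rangeProj, rangeProj_mul_self hM, ← rangeProj]

lemma trace_rangeProj {M : Matrix ι κ ℝ} (hM : IsUnit (Mᵀ * M).det) :
    (rangeProj M).trace = Fintype.card κ := by
  rw [rangeProj, Matrix.trace_mul_comm, ← Matrix.mul_assoc, Matrix.mul_nonsing_inv _ hM,
    Matrix.trace_one]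

lemma rangeProj_apply_self {M : Matrix ι κ ℝ} (hM : IsUnit (Mᵀ * M).det) (i : ι) :
    rangeProj M i i = ∑ j, rangeProj M i j ^ 2 := by
  have h : rangeProj M * (rangeProj M)ᵀ = rangeProj M := by
    rw [transpose_rangeProj, isIdempotentElem_rangeProj hM]
  have := congrFun (congrFun h i) i
  simpa [Matrix.mul_apply, sq] using this.symm

variable [DecidableEq ι]

lemma rangeProj_mul_left {V : Matrix ι ι ℝ} (hV : Vᵀ * V = 1) (N : Matrix ι κ ℝ) :
    rangeProj (V * N) = V * rangeProj N * Vᵀ := by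
  have h : (V * N)ᵀ * (V * N) = Nᵀ * N := by
    rw [Matrix.transpose_mul, Matrix.mul_assoc, ← Matrix.mul_assoc Vᵀ, hV, Matrix.one_mul]
  rw [rangeProj, h, rangeProj, Matrix.transpose_mul]
  simp only [Matrix.mul_assoc]

lemma sum_rangeProj_sub_one_sq {M : Matrix ι κ ℝ} (hM : IsUnit (Mᵀ * M).det) (i : ι) :
    ∑ j, (rangeProj M - 1) i j ^ 2 = 1 - rangeProj M i i := by
  have h : (rangeProj M - 1) * (rangeProj M - 1)ᵀ = 1 - rangeProj M := by
    rw [Matrix.transpose_sub, transpose_rangeProj, Matrix.transpose_one, Matrix.sub_mul,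
      Matrix.mul_sub, isIdempotentElem_rangeProj hM]
    simp
  have := congrFun (congrFun h i) i
  simp only [Matrix.mul_apply, Matrix.transpose_apply] at this
  simpa only [sq, Matrix.sub_apply, Matrix.one_apply_eq] using this

lemma sum_mulVec_sub_sq_le {M : Matrix ι κ ℝ} (hM : IsUnit (Mᵀ * M).det) (y : ι → ℝ) :
    ((rangeProj M - 1) *ᵥ y) ⬝ᵥ ((rangeProj M - 1) *ᵥ y) ≤ y ⬝ᵥ y := by
  set P := rangeProj M
  have hPP : (P *ᵥ y) ⬝ᵥ (P *ᵥ y) = y ⬝ᵥ P *ᵥ y := by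
    have : (P *ᵥ y) ⬝ᵥ (P *ᵥ y) = (y ᵥ* Pᵀ) ⬝ᵥ (P *ᵥ y) := by rw [Matrix.vecMul_transpose]
    rw [this, ← Matrix.dotProduct_mulVec, Matrix.mulVec_mulVec, transpose_rangeProj,
      isIdempotentElem_rangeProj hM]
  have h0 : 0 ≤ (P *ᵥ y) ⬝ᵥ (P *ᵥ y) := by
    rw [dotProduct]
    exact Finset.sum_nonneg fun i _ => mul_self_nonneg _
  simp only [Matrix.sub_mulVec, Matrix.one_mulVec, sub_dotProduct, dotProduct_sub]
  rw [dotProduct_comm (P *ᵥ y) y]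
  linarith

/-- The squared norm of the `i`-th row of `diag σ (P - 1)`, where `P` is the orthogonal
projection onto the range of `diag σ · B`. -/
noncomputable def projError (σ : ι → ℝ) (B : ι → κ → ℝ) (i : ι) : ℝ :=
  σ i ^ 2 * ∑ j, (rangeProj (Matrix.diagonal σ * Matrix.of B) - 1) i j ^ 2

lemma projError_nonneg (σ : ι → ℝ) (B : ι → κ → ℝ) (i : ι) : 0 ≤ projError σ B i := by
  unfold projError
  positivity

/-- The Gram matrix of the columns of `diag σ · B`. -/
def weightedGram (σ : ι → ℝ) (B : ι → κ → ℝ) : Matrix κ κ ℝ :=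
  (Matrix.diagonal σ * Matrix.of B)ᵀ * (Matrix.diagonal σ * Matrix.of B)

variable {σ : ι → ℝ} {B : ι → κ → ℝ}

lemma projError_le_sq (hB : IsUnit (weightedGram σ B).det) (i : ι) :
    projError σ B i ≤ σ i ^ 2 := by
  unfold projError
  rw [sum_rangeProj_sub_one_sq hB, rangeProj_apply_self hB]
  refine mul_le_of_le_one_right (sq_nonneg _) ?_
  have : 0 ≤ ∑ j, rangeProj (Matrix.diagonal σ * Matrix.of B) i j ^ 2 := by positivity
  linarith

/-- The error `projError` is at most the squared distance to any particular point of the range. -/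
lemma projError_le_sum_sq (hB : IsUnit (weightedGram σ B).det) (i : ι) (w : κ → ℝ) :
    projError σ B i ≤ ∑ j, ((if j = i then σ i else 0) - σ j * (B j ⬝ᵥ w)) ^ 2 := by
  set M := Matrix.diagonal σ * Matrix.of B with hMdef
  set v : ι → ℝ := Pi.single i (σ i)
  have h0 : (rangeProj M - 1) *ᵥ (M *ᵥ w) = 0 := by
    rw [Matrix.mulVec_mulVec, Matrix.sub_mul, hMdef, rangeProj_mul_self hB]
    simp
  have h1 : projError σ B i = ((rangeProj M - 1) *ᵥ v) ⬝ᵥ ((rangeProj M - 1) *ᵥ v) := by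
    have hs (j : ι) : (rangeProj M - 1) j i = (rangeProj M - 1) i j := by
      have : (rangeProj M - 1)ᵀ = rangeProj M - 1 := by
        rw [Matrix.transpose_sub, transpose_rangeProj, Matrix.transpose_one]
      rw [← this, Matrix.transpose_apply, this]
    simp only [projError, v, Matrix.mulVec_single, dotProduct, Finset.mul_sum]
    refine Finset.sum_congr rfl fun j _ => ?_
    simp only [Pi.smul_apply, Matrix.col_apply, hs]
    simp [M]
    ring
  have h2 := sum_mulVec_sub_sq_le hB (v - M *ᵥ w)
  rw [Matrix.mulVec_sub, h0, sub_zero, ← h1] at h2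
  refine h2.trans_eq ?_
  simp only [dotProduct]
  refine Finset.sum_congr rfl fun j _ => ?_
  have : (M *ᵥ w) j = σ j * (B j ⬝ᵥ w) := by
    rw [hMdef, ← Matrix.mulVec_mulVec, Matrix.mulVec_diagonal]
    rfl
  rw [Pi.sub_apply, this, sq]
  simp [v, Pi.single_apply, dotProduct]

end RangeProj

lemma sum_sq_le_sum_projError {n m : ℕ} (hmn : m < n) {σ : Fin n → ℝ} {B : Fin n → Fin m → ℝ}
    (hσ_anti : Antitone σ) (hσ_pos : ∀ i, 0 < σ i)
    (hB : IsUnit (weightedGram σ B).det) :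
    ∑ i ∈ Finset.univ.filter (fun i : Fin n => m ≤ (i : ℕ)), σ i ^ 2 ≤ ∑ i, projError σ B i := by
  set P := rangeProj (Matrix.diagonal σ * Matrix.of B) with hP
  have hres (i : Fin n) : projError σ B i = σ i ^ 2 * (1 - P i i) := by
    rw [projError, sum_rangeProj_sub_one_sq hB]
  have h0 (i : Fin n) : 0 ≤ P i i := by
    rw [hP, rangeProj_apply_self hB]; positivity
  have h1 (i : Fin n) : P i i ≤ 1 := by
    have := sum_rangeProj_sub_one_sq hB i
    have h : 0 ≤ ∑ j, (P - 1) i j ^ 2 := by positivity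
    linarith
  have htr : ∑ i, P i i = m := by
    have := trace_rangeProj hB
    simpa [Matrix.trace] using this
  have hcard : ∑ i : Fin n, (if m ≤ (i : ℕ) then (0 : ℝ) else 1) = m := by
    simp only [← not_lt, ite_not, Finset.sum_boole]
    simp [Fin.card_filter_val_lt, hmn.le]
  let τ := σ ⟨m, hmn⟩ ^ 2
  have key (i : Fin n) : (if m ≤ (i : ℕ) then σ i ^ 2 else 0) ≤ projError σ B i
      + τ * (P i i - if m ≤ (i : ℕ) then 0 else 1) := by
    rw [hres]
    split_ifs with hi
    · have : σ i ^ 2 ≤ τ := pow_le_pow_left₀ (hσ_pos _).le (hσ_anti (by simpa [Fin.le_def])) 2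
      nlinarith [h0 i]
    · have : τ ≤ σ i ^ 2 := pow_le_pow_left₀ (hσ_pos _).le
        (hσ_anti (by rw [Fin.le_def]; simp; omega)) 2
      nlinarith [h1 i]
  rw [Finset.sum_filter]
  refine (Finset.sum_le_sum fun i _ => key i).trans_eq ?_
  rw [Finset.sum_add_distrib, ← Finset.mul_sum, Finset.sum_sub_distrib, htr, hcard]
  simp

lemma ae_dotProduct_ne_zero {n : ℕ} {c : Fin n → ℝ} (hc : c ≠ 0) :
    ∀ᵐ x ∂stdGaussianVec n, c ⬝ᵥ x ≠ 0 := by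
  have hpos : 0 < c ⬝ᵥ c := by
    rw [dotProduct]
    obtain ⟨i, hi⟩ := Function.ne_iff.1 hc
    exact Finset.sum_pos' (fun _ _ => mul_self_nonneg _)
      ⟨i, Finset.mem_univ _, mul_self_pos.2 hi⟩
  let W : Matrix (Fin 1) (Fin n) ℝ := Matrix.of fun _ j => (√(c ⬝ᵥ c))⁻¹ * c j
  have hW : W * Wᵀ = 1 := by
    ext i j
    have : (W * Wᵀ) i j = (√(c ⬝ᵥ c))⁻¹ ^ 2 * (c ⬝ᵥ c) := by
      simp only [Matrix.mul_apply, W, Matrix.transpose_apply, Matrix.of_apply, dotProduct,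
        Finset.mul_sum]
      exact Finset.sum_congr rfl fun k _ => by ring
    rw [this, Subsingleton.elim i j, Matrix.one_apply_eq, inv_pow, Real.sq_sqrt hpos.le,
      inv_mul_cancel₀ hpos.ne']
  have h1 : ∀ᵐ y ∂stdGaussianVec 1, y 0 ≠ 0 := by
    have h : ∀ᵐ z ∂gaussianReal 0 1, z ≠ 0 := by
      have := nullSingletonClass_gaussianReal (μ := 0) (one_ne_zero (α := NNReal))
      simp [ae_iff, measure_singleton]
    exact (measurePreserving_eval (fun _ : Fin 1 => gaussianReal 0 1) 0).quasiMeasurePreserving.ae h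
  filter_upwards [(measurePreserving_mulVec_stdGaussianVec W hW).quasiMeasurePreserving.ae h1]
    with x hx h0
  refine hx ?_
  simp only [Matrix.mulVec, W, dotProduct, Matrix.of_apply, mul_assoc, ← Finset.mul_sum]
  exact mul_eq_zero_of_right _ h0

lemma ae_notMem_submodule {n : ℕ} {S : Submodule ℝ (Fin n → ℝ)} (hS : S < ⊤) :
    ∀ᵐ x ∂stdGaussianVec n, x ∉ S := by
  obtain ⟨f, hf, hle⟩ := S.exists_le_ker_of_lt_top hS
  have hfc (x : Fin n → ℝ) : f x = (fun i => f (Pi.single i 1)) ⬝ᵥ x := by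
    conv_lhs => rw [LinearMap.pi_apply_eq_sum_univ f x]
    simp only [dotProduct, smul_eq_mul, mul_comm]
    refine Finset.sum_congr rfl fun i _ => ?_
    congr 2
    ext j
    simp [Pi.single_apply, eq_comm]
  have hc : (fun i => f (Pi.single i 1)) ≠ 0 := fun h => hf <| LinearMap.ext fun x => by
    rw [hfc, h]; simp
  filter_upwards [ae_dotProduct_ne_zero hc] with x hx hxS
  exact hx ((hfc x).symm.trans (hle hxS))

lemma ae_linearIndependent_stdGaussianMat {m n : ℕ} (hmn : m ≤ n) :
    ∀ᵐ A ∂stdGaussianMat m n, LinearIndependent ℝ A := by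
  induction m with
  | zero => exact .of_forall fun A => linearIndependent_empty_type
  | succ m ih =>
    have hmeas : MeasurableSet {A : Fin (m + 1) → Fin n → ℝ | LinearIndependent ℝ A} :=
      isOpen_setOfPred_linearIndependent.measurableSet
    have e := measurePreserving_piFinSuccAbove (fun _ : Fin (m + 1) => stdGaussianVec n) 0
    rw [stdGaussianMat, ← e.symm.map_eq, ae_map_iff (by fun_prop) hmeas]
    refine (Measure.ae_prod_iff_ae_ae (e.symm.measurable hmeas)).2 ?_
    refine (Measure.ae_ae_comm (p := fun a A => LinearIndependent ℝ
      ((MeasurableEquiv.piFinSuccAbove (fun _ => Fin n → ℝ) 0).symm (a, A)))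
      (e.symm.measurable hmeas)).2 ?_
    filter_upwards [ih (by omega)] with A hA
    have hlt : Submodule.span ℝ (Set.range A) < ⊤ := by
      refine Submodule.lt_top_of_finrank_lt_finrank ?_
      have := finrank_range_le_card (R := ℝ) A
      rw [Set.finrank] at this
      simp at this ⊢
      omega
    filter_upwards [ae_notMem_submodule hlt] with a ha
    have := linearIndependent_finCons.2 ⟨hA, ha⟩
    simpa [MeasurableEquiv.piFinSuccAbove_symm_apply, Fin.insertNthEquiv] using this

lemma isUnit_det_of_linearIndependent {m n : ℕ} {A : Fin m → Fin n → ℝ}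
    (hA : LinearIndependent ℝ A) {G : Matrix (Fin n) (Fin n) ℝ} (hG : IsUnit G.det) :
    IsUnit (Matrix.of A * G * Gᵀ * (Matrix.of A)ᵀ).det := by
  have hG' : IsUnit G := (Matrix.isUnit_iff_isUnit_det G).2 hG
  have hinj : Function.Injective ((Matrix.of A * G).vecMul) := by
    intro v w hvw
    simp only [← Matrix.vecMul_vecMul] at hvw
    exact Matrix.vecMul_injective_iff.2 hA (Matrix.vecMul_injective_of_isUnit hG' hvw)
  have := (Matrix.PosDef.mul_conjTranspose_self _ hinj).det_pos.ne'.isUnit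
  simpa [Matrix.mul_assoc] using this

/-- Three orthonormal vectors orthogonal to at most `m - 3` given vectors of `ℝᵐ`. -/
lemma exists_orthonormal_rows {ι : Type*} {m : ℕ} (x : ι → Fin m → ℝ) (t : Finset ι)
    (ht : t.card + 3 ≤ m) :
    ∃ W : Matrix (Fin 3) (Fin m) ℝ, W * Wᵀ = 1 ∧ ∀ j ∈ t, W *ᵥ x j = 0 := by
  classical
  let S : Submodule ℝ (EuclideanSpace ℝ (Fin m)) :=
    Submodule.span ℝ (t.image fun j => WithLp.toLp 2 (x j))
  have hS : Module.finrank ℝ S ≤ t.card :=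
    (finrank_span_finset_le_card _).trans Finset.card_image_le
  have h3 : 3 ≤ Module.finrank ℝ Sᗮ := by
    have := S.finrank_add_finrank_orthogonal
    rw [finrank_euclideanSpace_fin] at this
    omega
  let u : Fin 3 → EuclideanSpace ℝ (Fin m) :=
    fun l => (stdOrthonormalBasis ℝ Sᗮ (Fin.castLE h3 l) : Sᗮ)
  have hu : Orthonormal ℝ u :=
    ((stdOrthonormalBasis ℝ Sᗮ).orthonormal.comp _ (Fin.castLE_injective h3)).comp_linearIsometry
      Sᗮ.subtypeₗᵢ
  refine ⟨Matrix.of fun l => (u l).ofLp, ?_, fun j hj => ?_⟩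
  · ext l l'
    have := orthonormal_iff_ite.1 hu l l'
    rw [EuclideanSpace.inner_eq_star_dotProduct] at this
    rw [Matrix.one_apply, ← this, dotProduct_comm]
    rfl
  · ext l
    have hmem : WithLp.toLp 2 (x j) ∈ S :=
      Submodule.subset_span (Finset.mem_coe.2 (Finset.mem_image_of_mem _ hj))
    have := (Submodule.mem_orthogonal _ _).1
      (stdOrthonormalBasis ℝ Sᗮ (Fin.castLE h3 l) : Sᗮ).2 _ hmem
    rw [EuclideanSpace.inner_eq_star_dotProduct] at this
    exact this

section Measurability

variable {ι κ X : Type*} [Fintype ι] [Fintype κ] [DecidableEq κ]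
  [TopologicalSpace X] [MeasurableSpace X] [BorelSpace X]

lemma measurable_rangeProj_apply {M : X → Matrix ι κ ℝ} (hM : Continuous M) (i j : ι) :
    Measurable fun x => rangeProj (M x) i j := by
  have h (x : X) : rangeProj (M x) i j =
      ((M x)ᵀ * M x).det⁻¹ * (M x * ((M x)ᵀ * M x).adjugate * (M x)ᵀ) i j := by
    rw [rangeProj, Matrix.inv_def, Matrix.mul_smul, Matrix.smul_mul, Matrix.smul_apply,
      Ring.inverse_eq_inv', smul_eq_mul]
  simp_rw [h]
  have h1 : Continuous fun x => ((M x)ᵀ * M x).det := by fun_prop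
  have h2 : Continuous fun x => (M x * ((M x)ᵀ * M x).adjugate * (M x)ᵀ) i j :=
    Continuous.matrix_elem (by fun_prop) i j
  exact h1.measurable.inv.mul h2.measurable

end Measurability

lemma measurable_projError {n m : ℕ} (σ : Fin n → ℝ) (i : Fin n) :
    Measurable fun B : Fin n → Fin m → ℝ => projError σ B i := by
  have h : Continuous fun B : Fin n → Fin m → ℝ => Matrix.diagonal σ * Matrix.of B :=
    continuous_const.matrix_mul continuous_id
  unfold projError
  simp only [Matrix.sub_apply]
  have := measurable_rangeProj_apply h
  fun_prop

lemma measurableSet_det_weightedGram_ne_zero {n m : ℕ} (σ : Fin n → ℝ) :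
    MeasurableSet {B : Fin n → Fin m → ℝ | (weightedGram σ B).det ≠ 0} := by
  have h : Continuous fun B : Fin n → Fin m → ℝ => Matrix.diagonal σ * Matrix.of B :=
    continuous_const.matrix_mul continuous_id
  have h' : Continuous fun B : Fin n → Fin m → ℝ => (weightedGram σ B).det := by
    unfold weightedGram
    fun_prop
  exact (isOpen_ne_fun h' continuous_const).measurableSet

lemma lintegral_sum_dotProduct_sq {ι : Type*} [Fintype ι] {m : ℕ} (σ : ι → ℝ) (w : Fin m → ℝ) :
    ∫⁻ y : ι → Fin m → ℝ, ENNReal.ofReal (∑ j, σ j ^ 2 * (y j ⬝ᵥ w) ^ 2)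
      ∂Measure.pi (fun _ => stdGaussianVec m) = ENNReal.ofReal ((∑ j, σ j ^ 2) * (w ⬝ᵥ w)) := by
  have hdot : Measurable fun z : Fin m → ℝ => z ⬝ᵥ w := by unfold dotProduct; fun_prop
  have h (j : ι) : ∫⁻ y : ι → Fin m → ℝ, ENNReal.ofReal (σ j ^ 2 * (y j ⬝ᵥ w) ^ 2)
      ∂Measure.pi (fun _ => stdGaussianVec m) = ENNReal.ofReal (σ j ^ 2 * (w ⬝ᵥ w)) := by
    rw [(measurePreserving_eval (fun _ : ι => stdGaussianVec m) j).lintegral_comp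
      (f := fun z : Fin m → ℝ => ENNReal.ofReal (σ j ^ 2 * (z ⬝ᵥ w) ^ 2)) (by fun_prop),
      ← ofReal_integral_eq_lintegral_ofReal]
    · simp_rw [dotProduct_comm _ w]
      rw [integral_const_mul, integral_dotProduct_sq]
      simp [dotProduct, sq]
    · simp_rw [dotProduct_comm _ w]
      exact (integrable_dotProduct_sq w).const_mul _
    · exact .of_forall fun z => by positivity
  have hmeas (j : ι) : Measurable fun y : ι → Fin m → ℝ =>
      ENNReal.ofReal (σ j ^ 2 * (y j ⬝ᵥ w) ^ 2) := by fun_prop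
  have hsum (y : ι → Fin m → ℝ) : ENNReal.ofReal (∑ j, σ j ^ 2 * (y j ⬝ᵥ w) ^ 2) =
      ∑ j, ENNReal.ofReal (σ j ^ 2 * (y j ⬝ᵥ w) ^ 2) :=
    ENNReal.ofReal_sum_of_nonneg fun j _ => by positivity
  simp_rw [hsum]
  rw [lintegral_finsetSum _ fun j _ => hmeas j, Finset.sum_mul,
    ENNReal.ofReal_sum_of_nonneg fun j _ => ?_]
  · simp_rw [h]
  · have : 0 ≤ w ⬝ᵥ w := by rw [dotProduct]; exact Finset.sum_nonneg fun i _ => mul_self_nonneg _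
    positivity

/-- The projection error, set to zero where the Gram matrix is singular. -/
noncomputable def regularError {n m : ℕ} (σ : Fin n → ℝ) (i : Fin n) :
    (Fin n → Fin m → ℝ) → ENNReal :=
  {B | (weightedGram σ B).det ≠ 0}.indicator fun B => ENNReal.ofReal (projError σ B i)

lemma measurable_regularError {n m : ℕ} (σ : Fin n → ℝ) (i : Fin n) :
    Measurable (regularError (m := m) σ i) :=
  (measurable_projError σ i).ennreal_ofReal.indicator (measurableSet_det_weightedGram_ne_zero σ)

lemma regularError_le {n m : ℕ} {σ : Fin n → ℝ} {i : Fin n} {B : Fin n → Fin m → ℝ} {c : ℝ}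
    (h : IsUnit (weightedGram σ B).det → projError σ B i ≤ c) :
    regularError σ i B ≤ ENNReal.ofReal c := by
  by_cases hB : B ∈ {B | (weightedGram σ B).det ≠ 0}
  · rw [regularError, Set.indicator_of_mem hB]
    exact ENNReal.ofReal_le_ofReal (h (isUnit_iff_ne_zero.2 hB))
  · rw [regularError, Set.indicator_of_notMem hB]
    exact zero_le

/-- Average of the error over the vectors indexed by `s`, in terms of the component of `x i`
orthogonal to the remaining vectors. -/
lemma lmarginal_regularError_le {n m : ℕ} {σ : Fin n → ℝ} {i : Fin n} {s : Finset (Fin n)}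
    (hi : i ∉ s) (hs : 0 < ∑ j ∈ s, σ j ^ 2) (x : Fin n → Fin m → ℝ)
    {W : Matrix (Fin 3) (Fin m) ℝ} (hW : W * Wᵀ = 1)
    (hWx : ∀ j, j ∉ s → j ≠ i → W *ᵥ x j = 0) :
    lmarginal (fun _ => stdGaussianVec m) s (regularError σ i) x ≤
      ENNReal.ofReal (∑ j ∈ s, σ j ^ 2) *
        ∫⁻ t in Set.Ioi (0 : ℝ), ENNReal.ofReal (Real.exp (-t * ∑ l, (W *ᵥ x i) l ^ 2)) := by
  set r := ∑ l, (W *ᵥ x i) l ^ 2 with hr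
  have hr0 : 0 ≤ r := by positivity
  rcases hr0.eq_or_lt with h0 | hpos
  · simp [← h0, ENNReal.mul_top, hs]
  rw [lintegral_Ioi_exp_neg_mul hpos, ← ENNReal.ofReal_mul hs.le]
  have hr' : (W *ᵥ x i) ⬝ᵥ (W *ᵥ x i) = r := by simp [hr, dotProduct, sq]
  set w : Fin m → ℝ := r⁻¹ • (Wᵀ *ᵥ (W *ᵥ x i)) with hw
  have hdot (z : Fin m → ℝ) : z ⬝ᵥ w = r⁻¹ * ((W *ᵥ z) ⬝ᵥ (W *ᵥ x i)) := by
    rw [hw, dotProduct_smul, Matrix.dotProduct_mulVec, Matrix.vecMul_transpose, smul_eq_mul]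
  have hWw : W *ᵥ w = r⁻¹ • (W *ᵥ x i) := by
    rw [hw, Matrix.mulVec_smul, Matrix.mulVec_mulVec, hW, Matrix.one_mulVec]
  have hww : w ⬝ᵥ w = r⁻¹ := by
    rw [hdot, hWw, smul_dotProduct, hr', smul_eq_mul, inv_mul_cancel₀ hpos.ne', mul_one]
  have hxi : x i ⬝ᵥ w = 1 := by rw [hdot, hr', inv_mul_cancel₀ hpos.ne']
  have hxj (j : Fin n) (hj : j ∉ s) (hji : j ≠ i) : x j ⬝ᵥ w = 0 := by
    rw [hdot, hWx j hj hji, zero_dotProduct, mul_zero]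
  have hsum := lintegral_sum_dotProduct_sq (fun j : s => σ j) w
  rw [hww, Finset.sum_coe_sort s (fun j => σ j ^ 2)] at hsum
  rw [← hsum, lmarginal]
  refine lintegral_mono fun y => regularError_le fun hB => ?_
  refine (projError_le_sum_sq hB i w).trans_eq ?_
  rw [← Finset.sum_subset (Finset.subset_univ s), ← Finset.sum_coe_sort s]
  · refine Finset.sum_congr rfl fun j _ => ?_
    have hji : (j : Fin n) ≠ i := fun h => hi (h ▸ j.2)
    simp [Function.updateFinset, hji]
    ring
  · intro j _ hj
    by_cases hji : j = i
    · subst hji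
      simp [Function.updateFinset, hj, hxi]
    · simp [Function.updateFinset, hj, hji, hxj j hj hji]

lemma lintegral_regularError_le {n m : ℕ} (hm4 : 4 ≤ m) (hmn : m < n) {σ : Fin n → ℝ}
    (hσ_pos : ∀ i, 0 < σ i) {i : Fin n} (hi : (i : ℕ) < m - 2) :
    ∫⁻ B, regularError σ i B ∂stdGaussianMat n m ≤
      ENNReal.ofReal (∑ j ∈ Finset.univ.filter (fun j : Fin n => m - 2 ≤ (j : ℕ)), σ j ^ 2) := by
  set s := Finset.univ.filter (fun j : Fin n => m - 2 ≤ (j : ℕ)) with hs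
  have his : i ∉ s := by simp [hs]; omega
  have hpos : 0 < ∑ j ∈ s, σ j ^ 2 :=
    Finset.sum_pos (fun j _ => pow_pos (hσ_pos j) 2) ⟨⟨m, hmn⟩, by simp [hs]⟩
  have hmargin : lmarginal (fun _ => stdGaussianVec m) (insert i s) (regularError σ i) ≤
      lmarginal (fun _ => stdGaussianVec m) (insert i s)
        (fun _ => ENNReal.ofReal (∑ j ∈ s, σ j ^ 2)) := by
    intro x
    let t := (Finset.univ.filter fun j : Fin n => (j : ℕ) < m - 2).erase i
    have ht : t.card + 3 ≤ m := by
      rw [Finset.card_erase_of_mem (by simp [hi]), Fin.card_filter_val_lt]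
      omega
    obtain ⟨W, hW, hWx⟩ := exists_orthonormal_rows x t ht
    rw [lmarginal_insert _ (measurable_regularError σ i) his]
    calc _ ≤ ∫⁻ b, ENNReal.ofReal (∑ j ∈ s, σ j ^ 2) * (∫⁻ u in Set.Ioi (0 : ℝ),
          ENNReal.ofReal (Real.exp (-u * ∑ l, (W *ᵥ b) l ^ 2))) ∂stdGaussianVec m := by
          refine lintegral_mono fun b => ?_
          refine (lmarginal_regularError_le his hpos (Function.update x i b) hW ?_).trans_eq ?_
          · intro j hj hji
            rw [Function.update_of_ne hji]
            exact hWx j (by simp [hs] at hj; simp [t, hji]; omega)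
          · rw [Function.update_self]
      _ = ENNReal.ofReal (∑ j ∈ s, σ j ^ 2) := by
          rw [lintegral_const_mul' _ _ ENNReal.ofReal_ne_top,
            lintegral_lintegral_exp_neg_norm_mulVec_sq W hW, mul_one]
      _ = _ := by simp [lmarginal]
  have := lintegral_le_of_lmarginal_le (insert i s) (measurable_regularError σ i)
    measurable_const hmargin
  refine this.trans_eq ?_
  simp

/-- Both iterated products of standard Gaussians are the product over all entries. -/
lemma map_uncurry_stdGaussianMat (m n : ℕ) :
    (stdGaussianMat m n).map (fun A (p : Fin m × Fin n) => A p.1 p.2) =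
      Measure.pi fun _ => gaussianReal 0 1 := by
  refine (Measure.pi_eq fun s hs => ?_).symm
  rw [Measure.map_apply (by fun_prop) (MeasurableSet.univ_pi hs)]
  have h : (fun (A : Fin m → Fin n → ℝ) (p : Fin m × Fin n) => A p.1 p.2) ⁻¹' Set.univ.pi s =
      Set.univ.pi fun i => Set.univ.pi fun j => s (i, j) := by
    ext A
    simp
  rw [h, stdGaussianMat, Measure.pi_pi, Fintype.prod_prod_type]
  simp_rw [stdGaussianVec, Measure.pi_pi]

lemma measurePreserving_swap_stdGaussianMat (m n : ℕ) :
    MeasurePreserving (fun (A : Fin m → Fin n → ℝ) j i => A i j)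
      (stdGaussianMat m n) (stdGaussianMat n m) := by
  refine ⟨by fun_prop, ?_⟩
  let c : (Fin n × Fin m → ℝ) → Fin n → Fin m → ℝ := fun z j i => z (j, i)
  have hc : Measurable c := by fun_prop
  have hswap : MeasurePreserving (fun (z : Fin m × Fin n → ℝ) (p : Fin n × Fin m) => z p.swap)
      (Measure.pi fun _ => gaussianReal 0 1) (Measure.pi fun _ => gaussianReal 0 1) := by
    refine ⟨by fun_prop, (Measure.pi_eq fun s hs => ?_).symm⟩
    rw [Measure.map_apply (by fun_prop) (MeasurableSet.univ_pi hs)]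
    have h : (fun (z : Fin m × Fin n → ℝ) (p : Fin n × Fin m) => z p.swap) ⁻¹' Set.univ.pi s =
        Set.univ.pi fun q => s q.swap := by
      ext z
      simp only [Set.mem_preimage, Set.mem_univ_pi, Prod.forall, Prod.swap_prod_mk]
      exact forall_comm
    rw [h, Measure.pi_pi]
    exact (Equiv.prodComm (Fin m) (Fin n)).prod_comp fun p => gaussianReal 0 1 (s p)
  calc _ = (((stdGaussianMat m n).map (fun A (p : Fin m × Fin n) => A p.1 p.2)).map
        fun z (p : Fin n × Fin m) => z p.swap).map c := by
        rw [Measure.map_map (by fun_prop) (by fun_prop),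
          Measure.map_map (by fun_prop) (by fun_prop)]
        rfl
    _ = ((stdGaussianMat n m).map (fun A (p : Fin n × Fin m) => A p.1 p.2)).map c := by
        rw [map_uncurry_stdGaussianMat, map_uncurry_stdGaussianMat, hswap.map_eq]
    _ = stdGaussianMat n m := by
        rw [Measure.map_map (by fun_prop) (by fun_prop)]
        exact Measure.map_id

lemma measurePreserving_mul_transpose {m n : ℕ} {U : Matrix (Fin n) (Fin n) ℝ}
    (hU : Uᵀ * U = 1) :
    MeasurePreserving (fun (A : Fin m → Fin n → ℝ) j i => (Matrix.of A * U)ᵀ j i)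
      (stdGaussianMat m n) (stdGaussianMat n m) := by
  have h := measurePreserving_pi (fun _ : Fin m => stdGaussianVec n) (fun _ => stdGaussianVec n)
    fun _ => measurePreserving_mulVec_stdGaussianVec Uᵀ (by simpa using hU)
  have hcomp : (fun (A : Fin m → Fin n → ℝ) j i => (Matrix.of A * U)ᵀ j i) =
      (fun (A : Fin m → Fin n → ℝ) j i => A i j) ∘ fun A i => Uᵀ *ᵥ A i := by
    ext A j i
    simp [Matrix.mul_apply, Matrix.mulVec, dotProduct, mul_comm]
  rw [hcomp]
  exact (measurePreserving_swap_stdGaussianMat m n).comp h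

section SVD

variable {n m : ℕ} {G U V : Matrix (Fin n) (Fin n) ℝ} {σ : Fin n → ℝ}

lemma weightedGram_mul_transpose (hV : Vᵀ * V = 1) (hSVD : G = U * Matrix.diagonal σ * Vᵀ)
    (A : Fin m → Fin n → ℝ) :
    weightedGram σ (fun j i => (Matrix.of A * U)ᵀ j i) =
      Matrix.of A * G * Gᵀ * (Matrix.of A)ᵀ := by
  have h : G * Gᵀ = U * Matrix.diagonal σ * Matrix.diagonal σ * Uᵀ := by
    rw [hSVD, Matrix.transpose_mul, Matrix.mul_assoc _ Vᵀ, Matrix.transpose_transpose,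
      ← Matrix.mul_assoc Vᵀ, hV, Matrix.one_mul, Matrix.transpose_mul,
      Matrix.diagonal_transpose]
    simp only [Matrix.mul_assoc]
  rw [Matrix.mul_assoc (Matrix.of A) G, h]
  change (Matrix.diagonal σ * (Matrix.of A * U)ᵀ)ᵀ * (Matrix.diagonal σ * (Matrix.of A * U)ᵀ) = _
  simp only [Matrix.transpose_mul, Matrix.transpose_transpose, Matrix.diagonal_transpose,
    Matrix.mul_assoc]

lemma sum_mul_rangeProj_sub_one_sq (hU : Uᵀ * U = 1) (hV : Vᵀ * V = 1 ∧ V * Vᵀ = 1)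
    (hSVD : G = U * Matrix.diagonal σ * Vᵀ) (A : Fin m → Fin n → ℝ) :
    ∑ i, ∑ j, (G * (rangeProj (Gᵀ * (Matrix.of A)ᵀ) - 1)) i j ^ 2 =
      ∑ i, projError σ (fun j i => (Matrix.of A * U)ᵀ j i) i := by
  set N := Matrix.diagonal σ * (Matrix.of A * U)ᵀ with hN
  have hM : Gᵀ * (Matrix.of A)ᵀ = V * N := by
    rw [hN, hSVD]
    simp only [Matrix.transpose_mul, Matrix.transpose_transpose, Matrix.diagonal_transpose,
      Matrix.mul_assoc]
  have hinv (Y : Matrix (Fin n) (Fin n) ℝ) :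
      (U * Y * Vᵀ * (U * Y * Vᵀ)ᵀ).trace = (Y * Yᵀ).trace := by
    have h : U * Y * Vᵀ * (U * Y * Vᵀ)ᵀ = U * (Y * Yᵀ * Uᵀ) := by
      simp only [Matrix.transpose_mul, Matrix.transpose_transpose, Matrix.mul_assoc]
      rw [← Matrix.mul_assoc Vᵀ, hV.1, Matrix.one_mul]
    rw [h, Matrix.trace_mul_comm, Matrix.mul_assoc, hU, Matrix.mul_one]
  have htrace (X : Matrix (Fin n) (Fin n) ℝ) : ∑ i, ∑ j, X i j ^ 2 = (X * Xᵀ).trace := by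
    simp [Matrix.trace, Matrix.mul_apply, sq]
  have hX : G * (rangeProj (V * N) - 1) = U * (Matrix.diagonal σ * (rangeProj N - 1)) * Vᵀ := by
    rw [rangeProj_mul_left hV.1, hSVD, Matrix.mul_sub, Matrix.mul_sub, Matrix.mul_sub,
      Matrix.sub_mul]
    congr 1
    · simp only [← Matrix.mul_assoc]
      rw [Matrix.mul_assoc _ Vᵀ V, hV.1, Matrix.mul_one]
    · simp
  rw [hM, hX, htrace, hinv, ← htrace]
  refine Finset.sum_congr rfl fun i _ => ?_
  have hof : Matrix.diagonal σ * Matrix.of (fun j i => (Matrix.of A * U)ᵀ j i) = N := rfl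
  rw [projError, hof, Finset.mul_sum]
  refine Finset.sum_congr rfl fun j _ => ?_
  rw [Matrix.diagonal_mul, mul_pow]

end SVD

/-- The mean squared error for a fixed measurement matrix. -/
lemma integral_estimator_sub_sq {n m : ℕ} {G : Matrix (Fin n) (Fin n) ℝ} (hG : IsUnit G.det)
    (A : Fin m → Fin n → ℝ) :
    ∫ x₀, (∑ i, ((G * Gᵀ * (Matrix.of A)ᵀ * (Matrix.of A * G * Gᵀ * (Matrix.of A)ᵀ)⁻¹
        * Matrix.of A * G * G⁻¹).mulVec x₀ i - x₀ i) ^ 2)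
      ∂((stdGaussianVec n).map G.mulVec) =
    ∑ i, ∑ j, (G * (rangeProj (Gᵀ * (Matrix.of A)ᵀ) - 1)) i j ^ 2 := by
  have hmul : G * Gᵀ * (Matrix.of A)ᵀ * (Matrix.of A * G * Gᵀ * (Matrix.of A)ᵀ)⁻¹
      * Matrix.of A * G = G * rangeProj (Gᵀ * (Matrix.of A)ᵀ) := by
    simp only [rangeProj, Matrix.transpose_mul, Matrix.transpose_transpose, Matrix.mul_assoc]
  rw [hmul, integral_map (measurable_mulVec_left G).aemeasurable]
  · have h (z : Fin n → ℝ) (i : Fin n) :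
        ((G * rangeProj (Gᵀ * (Matrix.of A)ᵀ) * G⁻¹) *ᵥ (G *ᵥ z)) i - (G *ᵥ z) i =
          (fun j => (G * (rangeProj (Gᵀ * (Matrix.of A)ᵀ) - 1)) i j) ⬝ᵥ z := by
      rw [Matrix.mulVec_mulVec, Matrix.nonsing_inv_mul_cancel_right _ _ hG, Matrix.mul_sub,
        Matrix.mul_one, ← Pi.sub_apply, ← Matrix.sub_mulVec]
      rfl
    simp_rw [h]
    rw [integral_finsetSum _ fun i _ => integrable_dotProduct_sq _]
    simp_rw [integral_dotProduct_sq]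
  · exact Measurable.aestronglyMeasurable (by fun_prop)

/-- Let `G` be an invertible `n × n` real matrix with singular values
`σ₁ ≥ … ≥ σₙ > 0` (encoded by an SVD `G = U · diag σ · Vᵀ` with `U, V` orthogonal, `σ`
nonincreasing and positive), and let `4 ≤ m < n`.  Let `x₀ ~ N(0, G Gᵀ)` (the pushforward of
the standard Gaussian by `G`) and let `A` be an `m × n` matrix with i.i.d. `N(0,1)` entries.
With probability one `A G Gᵀ Aᵀ` is invertible, and the maximum likelihood estimator
`x̂ = G Gᵀ Aᵀ (A G Gᵀ Aᵀ)⁻¹ A G G⁻¹ x₀` satisfies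
`∑_{i>m} σᵢ² ≤ E_A E_{x₀} ‖x̂ − x₀‖² ≤ m ∑_{i>m−2} σᵢ²`
(sums over 1-indexed singular values, i.e. 0-indexed indices `≥ m` resp. `≥ m − 2`). -/
theorem statement0 {n m : ℕ} (hm4 : 4 ≤ m) (hmn : m < n)
    (G U V : Matrix (Fin n) (Fin n) ℝ) (σ : Fin n → ℝ)
    (hG : IsUnit G.det)
    (hU : Uᵀ * U = 1 ∧ U * Uᵀ = 1) (hV : Vᵀ * V = 1 ∧ V * Vᵀ = 1)
    (hσ_anti : Antitone σ) (hσ_pos : ∀ i, 0 < σ i)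
    (hSVD : G = U * Matrix.diagonal σ * Vᵀ) :
    (∀ᵐ A ∂(stdGaussianMat m n),
        IsUnit (Matrix.of A * G * Gᵀ * (Matrix.of A)ᵀ).det) ∧
    (∑ i ∈ Finset.univ.filter fun i : Fin n => m ≤ (i : ℕ), σ i ^ 2)
      ≤ (∫ A, ∫ x₀,
            (∑ i, ((G * Gᵀ * (Matrix.of A)ᵀ * (Matrix.of A * G * Gᵀ * (Matrix.of A)ᵀ)⁻¹
                      * Matrix.of A * G * G⁻¹).mulVec x₀ i - x₀ i) ^ 2)
            ∂((stdGaussianVec n).map G.mulVec) ∂(stdGaussianMat m n)) ∧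
    (∫ A, ∫ x₀,
        (∑ i, ((G * Gᵀ * (Matrix.of A)ᵀ * (Matrix.of A * G * Gᵀ * (Matrix.of A)ᵀ)⁻¹
                  * Matrix.of A * G * G⁻¹).mulVec x₀ i - x₀ i) ^ 2)
        ∂((stdGaussianVec n).map G.mulVec) ∂(stdGaussianMat m n))
      ≤ (m : ℝ) * ∑ i ∈ Finset.univ.filter fun i : Fin n => m - 2 ≤ (i : ℕ), σ i ^ 2 := by
  have hf := measurePreserving_mul_transpose (m := m) hU.1
  set f : (Fin m → Fin n → ℝ) → Fin n → Fin m → ℝ :=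
    fun A j i => (Matrix.of A * U)ᵀ j i with hfdef
  have hunit : ∀ᵐ A ∂(stdGaussianMat m n),
      IsUnit (Matrix.of A * G * Gᵀ * (Matrix.of A)ᵀ).det := by
    filter_upwards [ae_linearIndependent_stdGaussianMat hmn.le] with A hA
    exact isUnit_det_of_linearIndependent hA hG
  have hgram : ∀ᵐ A ∂(stdGaussianMat m n), IsUnit (weightedGram σ (f A)).det := by
    filter_upwards [hunit] with A hA
    rwa [hfdef, weightedGram_mul_transpose hV.1 hSVD]
  have hmeas (i : Fin n) : Measurable fun A => projError σ (f A) i :=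
    (measurable_projError σ i).comp hf.measurable
  have hint (i : Fin n) : Integrable (fun A => projError σ (f A) i) (stdGaussianMat m n) := by
    refine Integrable.of_bound (hmeas i).aestronglyMeasurable (σ i ^ 2) ?_
    filter_upwards [hgram] with A hA
    rw [Real.norm_of_nonneg (projError_nonneg _ _ _)]
    exact projError_le_sq hA i
  simp_rw [integral_estimator_sub_sq hG, sum_mul_rangeProj_sub_one_sq hU.1 hV hSVD]
  refine ⟨hunit, ?_, ?_⟩
  · have h := integral_mono_ae (integrable_const _) (integrable_finsetSum _ fun i _ => hint i)
      (hgram.mono fun A hA => sum_sq_le_sum_projError hmn hσ_anti hσ_pos hA)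
    simpa only [integral_const, probReal_univ, one_smul] using h
  rw [integral_finsetSum _ fun i _ => hint i]
  set T := ∑ i ∈ Finset.univ.filter (fun i : Fin n => m - 2 ≤ (i : ℕ)), σ i ^ 2 with hT
  have hT0 : 0 ≤ T := by positivity
  have hsmall (i : Fin n) (hi : (i : ℕ) < m - 2) :
      ∫ A, projError σ (f A) i ∂stdGaussianMat m n ≤ T := by
    rw [integral_eq_lintegral_of_nonneg_ae (.of_forall fun A => projError_nonneg _ _ _)
      (hmeas i).aestronglyMeasurable]
    refine ENNReal.toReal_le_of_le_ofReal hT0 ?_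
    calc _ = ∫⁻ A, regularError σ i (f A) ∂stdGaussianMat m n := by
          refine lintegral_congr_ae (hgram.mono fun A hA => ?_)
          have hA' : f A ∈ {B | (weightedGram σ B).det ≠ 0} := hA.ne_zero
          simp only [regularError, Set.indicator_of_mem hA']
      _ = ∫⁻ B, regularError σ i B ∂stdGaussianMat n m :=
          hf.lintegral_comp (measurable_regularError σ i)
      _ ≤ _ := lintegral_regularError_le hm4 hmn hσ_pos hi
  have hlarge (i : Fin n) : ∫ A, projError σ (f A) i ∂stdGaussianMat m n ≤ σ i ^ 2 := by
    have h := integral_mono_ae (hint i) (integrable_const (σ i ^ 2))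
      (hgram.mono fun A hA => projError_le_sq hA i)
    simpa using h
  calc ∑ i, ∫ A, projError σ (f A) i ∂stdGaussianMat m n
      ≤ ∑ i : Fin n, ((if (i : ℕ) < m - 2 then T else 0) +
          if m - 2 ≤ (i : ℕ) then σ i ^ 2 else 0) := by
        refine Finset.sum_le_sum fun i _ => ?_
        by_cases hi : (i : ℕ) < m - 2
        · simpa [hi, hi.not_ge] using hsmall i hi
        · simpa [hi, not_lt.1 hi] using hlarge i
    _ = (m - 2 : ℕ) * T + T := by
        rw [Finset.sum_add_distrib, ← Finset.sum_filter, ← Finset.sum_filter, ← hT,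
          Finset.sum_const, Fin.card_filter_val_lt, min_eq_right (by omega), nsmul_eq_mul]
    _ ≤ m * T := by
        rw [← add_one_mul]
        gcongr
        exact_mod_cast (by omega : m - 2 + 1 ≤ m)
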